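/- There exists an absolute constant C such that the following holds. Let d1, d2, n, r be positive integers and let (i_1,j_1),…,(i_n,j_n) be i.i.d. uniformly distributed on [d1] × [d2]. Then for every ζ ∈ (0,1), with probability at least 1−ζ, sup_{|||M|||≤1} | (d1 d2 / n) Σ_{k=1}^n M_{i_k j_k}² − ‖M‖_F² | ≤ C d1 d2 · max(t, √t), where t := max(r(d1+d2) ln³(d1+d2), ln²(1/ζ)) / n. -/

import Mathlib

open MeasureTheory ProbabilityTheory Matrix Real Set
open scoped ENNReal NNReal

noncomputable def frobNorm {m n : ℕ} (M : Matrix (Fin m) (Fin n) ℝ) : ℝ :=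
  Real.sqrt (∑ i, ∑ j, (M i j)^2)

/-- maximum ℓ2 norm of the columns of `M` -/
noncomputable def norm12 {m n : ℕ} (M : Matrix (Fin m) (Fin n) ℝ) : ℝ :=
  ⨆ j, Real.sqrt (∑ i, (M i j)^2)

/-- largest entry magnitude `‖M‖_∞` -/
noncomputable def entrySup {m n : ℕ} (M : Matrix (Fin m) (Fin n) ℝ) : ℝ :=
  ⨆ i, ⨆ j, |M i j|

/-- max-norm `‖M‖_max = inf {‖Uᵀ‖_{1→2} ‖Vᵀ‖_{1→2} : M = U Vᵀ}` -/
noncomputable def maxNorm {d1 d2 : ℕ} (M : Matrix (Fin d1) (Fin d2) ℝ) : ℝ :=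
  sInf {c | ∃ (d : ℕ) (U : Matrix (Fin d1) (Fin d) ℝ) (V : Matrix (Fin d2) (Fin d) ℝ),
    M = U * Vᵀ ∧ c = norm12 Uᵀ * norm12 Vᵀ}

/-- `|||M||| = max(‖M‖_∞, ‖M‖_max / √r)` -/
noncomputable def tripleNormMC {d1 d2 : ℕ} (r : ℕ) (M : Matrix (Fin d1) (Fin d2) ℝ) : ℝ :=
  max (entrySup M) (maxNorm M / Real.sqrt r)

open scoped BigOperators

/-- A real-valued function whose absolute value is bounded by a constant. -/
def BddFun {ι : Type*} (f : ι → ℝ) : Prop := ∃ B, ∀ i, |f i| ≤ B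

lemma BddFun.add {ι : Type*} {f g : ι → ℝ} (hf : BddFun f) (hg : BddFun g) :
    BddFun (fun i => f i + g i) := by
  obtain ⟨A, hA⟩ := hf
  obtain ⟨B, hB⟩ := hg
  exact ⟨A + B, fun i => (abs_add_le _ _).trans (add_le_add (hA i) (hB i))⟩

lemma BddFun.const_mul {ι : Type*} {f : ι → ℝ} (hf : BddFun f) (c : ℝ) :
    BddFun (fun i => c * f i) := by
  obtain ⟨A, hA⟩ := hf
  exact ⟨|c| * A, fun i => by
    rw [abs_mul]; exact mul_le_mul_of_nonneg_left (hA i) (abs_nonneg c)⟩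

lemma BddFun.sum {ι κ : Type*} (s : Finset κ) {f : κ → ι → ℝ} (hf : ∀ k, BddFun (f k)) :
    BddFun (fun i => ∑ k ∈ s, f k i) := by
  choose B hB using hf
  exact ⟨∑ k ∈ s, B k, fun i =>
    (Finset.abs_sum_le_sum_abs _ _).trans (Finset.sum_le_sum fun k _ => hB k i)⟩

lemma BddFun.bddAbove {ι : Type*} {f : ι → ℝ} (hf : BddFun f) : BddAbove (range f) := by
  obtain ⟨B, hB⟩ := hf
  exact ⟨B, by rintro _ ⟨i, rfl⟩; exact (abs_le.1 (hB i)).2⟩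

/-- The sign `±1` attached to a Boolean. -/
def boolSign (b : Bool) : ℝ := if b then 1 else -1

@[simp] lemma boolSign_true : boolSign true = 1 := rfl

@[simp] lemma boolSign_false : boolSign false = -1 := rfl

lemma boolSign_not (b : Bool) : boolSign (!b) = -boolSign b := by cases b <;> simp

lemma expect_bool (f : Bool → ℝ) : 𝔼 b, f b = (f true + f false) / 2 := by
  rw [Fintype.expect_eq_sum_div_card]; simp

lemma expect_mono {X : Type*} [Fintype X] {f g : X → ℝ} (h : ∀ x, f x ≤ g x) :
    𝔼 x, f x ≤ 𝔼 x, g x :=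
  Finset.expect_le_expect fun x _ => h x

lemma expect_congr_univ {X : Type*} [Fintype X] {f g : X → ℝ} (h : ∀ x, f x = g x) :
    𝔼 x, f x = 𝔼 x, g x :=
  Finset.expect_congr rfl fun x _ => h x

lemma expect_cons {X : Type*} [Fintype X] {n : ℕ} (F : (Fin (n + 1) → X) → ℝ) :
    𝔼 x, F x = 𝔼 y : Fin n → X, 𝔼 a, F (Fin.cons a y) := by
  rw [Finset.expect_comm, ← Finset.expect_product', Finset.univ_product_univ]
  exact (Fintype.expect_equiv (Fin.consEquiv fun _ => X) _ _ fun _ => rfl).symm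

/-- One-coordinate form of the Ledoux–Talagrand comparison. -/
lemma expect_iSup_boolSign_le {ι : Type*} [Nonempty ι] {h a b : ι → ℝ} (hh : BddFun h)
    (hb : BddFun b) (hab : ∀ i j, |a i - a j| ≤ |b i - b j|) :
    𝔼 e, ⨆ i, (h i + boolSign e * a i) ≤ 𝔼 e, ⨆ i, (h i + boolSign e * b i) := by
  have key : ∀ i j, (h i + a i) + (h j - a j) ≤ (⨆ i, (h i + b i)) + ⨆ i, (h i - b i) := by
    intro i j
    have up : ∀ i, h i + b i ≤ ⨆ i, (h i + b i) := le_ciSup (hh.add hb).bddAbove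
    have dn : ∀ i, h i - b i ≤ ⨆ i, (h i - b i) := by
      refine le_ciSup (f := fun i => h i - b i) ?_
      simpa [sub_eq_add_neg] using (hh.add (hb.const_mul (-1))).bddAbove
    have := (le_abs_self _).trans (hab i j)
    rcases abs_cases (b i - b j) with ⟨h1, _⟩ | ⟨h1, _⟩
    · linarith [up i, dn j]
    · linarith [up j, dn i]
  have : (⨆ i, (h i + a i)) + ⨆ i, (h i - a i) ≤ (⨆ i, (h i + b i)) + ⨆ i, (h i - b i) := by
    rw [← le_sub_iff_add_le]
    refine ciSup_le fun i => ?_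
    rw [le_sub_comm]
    refine ciSup_le fun j => ?_
    linarith [key i j]
  simp only [expect_bool, boolSign_true, boolSign_false, one_mul, neg_one_mul, ← sub_eq_add_neg]
  linarith

/-- The Ledoux–Talagrand contraction principle for Rademacher averages. -/
lemma rademacher_contraction {ι : Type*} [Nonempty ι] {n : ℕ} {a b : Fin n → ι → ℝ} {h : ι → ℝ}
    (hh : BddFun h) (ha : ∀ k, BddFun (a k)) (hb : ∀ k, BddFun (b k))
    (hab : ∀ k i j, |a k i - a k j| ≤ |b k i - b k j|) :
    𝔼 ε : Fin n → Bool, ⨆ i, (h i + ∑ k, boolSign (ε k) * a k i)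
      ≤ 𝔼 ε : Fin n → Bool, ⨆ i, (h i + ∑ k, boolSign (ε k) * b k i) := by
  induction n generalizing h with
  | zero => simp
  | succ n ih =>
    rw [expect_cons, expect_cons]
    simp only [Fin.sum_univ_succ, Fin.cons_zero, Fin.cons_succ]
    calc _ ≤ 𝔼 y : Fin n → Bool, 𝔼 e, ⨆ i,
          ((h i + ∑ k, boolSign (y k) * a k.succ i) + boolSign e * b 0 i) := by
          refine expect_mono fun y => ?_
          refine le_trans (le_of_eq ?_) (expect_iSup_boolSign_le (a := a 0)
            (hh.add (BddFun.sum _ fun k => (ha k.succ).const_mul _)) (hb 0) (hab 0))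
          exact expect_congr_univ fun e => iSup_congr fun i => by ring
      _ = 𝔼 e, 𝔼 y : Fin n → Bool, ⨆ i,
          ((h i + boolSign e * b 0 i) + ∑ k, boolSign (y k) * a k.succ i) := by
          rw [Finset.expect_comm]
          exact expect_congr_univ fun e => expect_congr_univ fun y => iSup_congr fun i => by ring
      _ ≤ 𝔼 e, 𝔼 y : Fin n → Bool, ⨆ i,
          ((h i + boolSign e * b 0 i) + ∑ k, boolSign (y k) * b k.succ i) :=
          expect_mono fun e => ih (hh.add ((hb 0).const_mul _)) (fun k => ha _) (fun k => hb _)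
            fun k => hab _
      _ = _ := by
          rw [Finset.expect_comm]
          exact expect_congr_univ fun e => expect_congr_univ fun y => iSup_congr fun i => by ring

lemma exp_le_add_exp_sq (z : ℝ) : Real.exp z ≤ z + Real.exp (z ^ 2) := by
  have h2 := Real.add_one_le_exp (z ^ 2)
  rcases le_or_gt |z| 1 with h | h
  · have := (abs_le.1 (Real.abs_exp_sub_one_sub_id_le h)).2
    linarith
  · rcases lt_abs.1 h with h | h
    · have : Real.exp z ≤ Real.exp (z ^ 2) := Real.exp_le_exp.2 (by nlinarith)
      linarith
    · have : Real.exp z ≤ 1 := Real.exp_le_one_iff.2 (by linarith)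
      nlinarith

lemma expect_exp_le_of_expect_eq_zero {X : Type*} [Fintype X] [Nonempty X] {f : X → ℝ} {c : ℝ}
    (h0 : 𝔼 x, f x = 0) (hc : ∀ x, |f x| ≤ c) : 𝔼 x, Real.exp (f x) ≤ Real.exp (c ^ 2) := by
  calc 𝔼 x, Real.exp (f x) ≤ 𝔼 x, (f x + Real.exp (c ^ 2)) := by
        refine expect_mono fun x => (exp_le_add_exp_sq _).trans ?_
        have := Real.exp_le_exp.2 (sq_le_sq.2 ((hc x).trans (le_abs_self c)))
        linarith
    _ = Real.exp (c ^ 2) := by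
        rw [Finset.expect_add_distrib, h0, Fintype.expect_const, zero_add]

/-- Exponential moment bound for functions with bounded differences. -/
lemma expect_exp_bounded_diff {X : Type*} [Fintype X] [Nonempty X] {n : ℕ}
    {F : (Fin n → X) → ℝ} {c : ℝ} (t : ℝ)
    (hF : ∀ x y k, (∀ l, l ≠ k → x l = y l) → F x - F y ≤ c) :
    𝔼 x, Real.exp (t * (F x - 𝔼 y, F y)) ≤ Real.exp (n * (t * c) ^ 2) := by
  induction n with
  | zero =>
    have : ∀ x, F x = F default := fun x => congrArg F (Subsingleton.elim _ _)
    simp [this]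
  | succ n ih =>
    set G : (Fin n → X) → ℝ := fun y => 𝔼 a, F (Fin.cons a y) with hG
    have hmean : 𝔼 y, F y = 𝔼 y, G y := expect_cons F
    have hGdiff : ∀ x y k, (∀ l, l ≠ k → x l = y l) → G x - G y ≤ c := by
      intro x y k hxy
      rw [hG]
      simp only
      rw [← Finset.expect_sub_distrib]
      refine Finset.expect_le Finset.univ_nonempty fun a _ => hF _ _ k.succ fun l hl => ?_
      refine Fin.cases ?_ (fun m hm => ?_) l hl
      · simp
      · simpa using hxy m (fun h => hm (by rw [h]))
    have hFG : ∀ y a, |t * (F (Fin.cons a y) - G y)| ≤ |t * c| := by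
      intro y a
      have h1 : ∀ a b, F (Fin.cons a y) - F (Fin.cons b y) ≤ c := fun a b =>
        hF _ _ 0 fun l hl => by
          obtain ⟨m, rfl⟩ := Fin.exists_succ_eq.2 hl
          simp
      have h2 : |F (Fin.cons a y) - G y| ≤ c := by
        rw [abs_le]
        constructor
        · have : G y ≤ F (Fin.cons a y) + c :=
            Finset.expect_le Finset.univ_nonempty fun b _ => by linarith [h1 b a]
          linarith
        · have : F (Fin.cons a y) - c ≤ G y :=
            Finset.le_expect Finset.univ_nonempty fun b _ => by linarith [h1 a b]
          linarith
      rw [abs_mul, abs_mul]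
      exact mul_le_mul_of_nonneg_left (h2.trans (le_abs_self c)) (abs_nonneg t)
    have hinner : ∀ y, 𝔼 a, Real.exp (t * (F (Fin.cons a y) - G y)) ≤ Real.exp ((t * c) ^ 2) := by
      intro y
      rw [← sq_abs (t * c)]
      refine expect_exp_le_of_expect_eq_zero ?_ (hFG y)
      rw [← Finset.mul_expect, Finset.expect_sub_distrib, Fintype.expect_const, hG, sub_self,
        mul_zero]
    calc 𝔼 x, Real.exp (t * (F x - 𝔼 y, F y))
        = 𝔼 y, (Real.exp (t * (G y - 𝔼 z, G z)) *
            𝔼 a, Real.exp (t * (F (Fin.cons a y) - G y))) := by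
          rw [expect_cons, hmean]
          refine expect_congr_univ fun y => ?_
          rw [Finset.mul_expect]
          refine expect_congr_univ fun a => ?_
          rw [← Real.exp_add]
          congr 1
          ring
      _ ≤ 𝔼 y, (Real.exp (t * (G y - 𝔼 z, G z)) * Real.exp ((t * c) ^ 2)) :=
          expect_mono fun y => mul_le_mul_of_nonneg_left (hinner y) (Real.exp_nonneg _)
      _ ≤ Real.exp (n * (t * c) ^ 2) * Real.exp ((t * c) ^ 2) := by
          rw [← Finset.expect_mul]
          exact mul_le_mul_of_nonneg_right (ih hGdiff) (Real.exp_nonneg _)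
      _ = _ := by
          rw [← Real.exp_add]
          congr 1
          push_cast
          ring

open Classical in
/-- McDiarmid's inequality for the uniform distribution on a finite power. -/
lemma mcdiarmid {X : Type*} [Fintype X] [Nonempty X] {n : ℕ} (hn : 0 < n)
    {F : (Fin n → X) → ℝ} {c u : ℝ} (hc : 0 < c) (hu : 0 ≤ u)
    (hF : ∀ x y k, (∀ l, l ≠ k → x l = y l) → F x - F y ≤ c) :
    𝔼 x, (if u ≤ F x - 𝔼 y, F y then (1 : ℝ) else 0) ≤ Real.exp (-(u ^ 2 / (4 * n * c ^ 2))) := by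
  have hn' : (0 : ℝ) < n := by exact_mod_cast hn
  set t := u / (2 * n * c ^ 2) with ht
  have ht0 : 0 ≤ t := by positivity
  calc _ ≤ 𝔼 x, (Real.exp (-(t * u)) * Real.exp (t * (F x - 𝔼 y, F y))) := by
        refine expect_mono fun x => ?_
        rw [← Real.exp_add]
        split_ifs with h
        · rw [Real.one_le_exp_iff]
          nlinarith
        · positivity
    _ ≤ Real.exp (-(t * u)) * Real.exp (n * (t * c) ^ 2) := by
        rw [← Finset.mul_expect]
        exact mul_le_mul_of_nonneg_left (expect_exp_bounded_diff t hF) (Real.exp_nonneg _)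
    _ = _ := by
        rw [← Real.exp_add, ht]
        congr 1
        field_simp
        ring

lemma expect_apply_coord {X : Type*} [Fintype X] [Nonempty X] {n : ℕ} (f : X → ℝ) (k : Fin n) :
    𝔼 x : Fin n → X, f (x k) = 𝔼 a, f a := by
  induction n with
  | zero => exact k.elim0
  | succ n ih =>
    rw [expect_cons]
    refine Fin.cases ?_ (fun m => ?_) k
    · simp only [Fin.cons_zero]
      rw [Fintype.expect_const]
    · simp only [Fin.cons_succ, Fintype.expect_const]
      exact ih m

/-- Exchange the `k`-th coordinates of a pair of samples wherever `ε k` is false. -/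
def swapSamples {X : Type*} {n : ℕ} (ε : Fin n → Bool) :
    ((Fin n → X) × (Fin n → X)) ≃ ((Fin n → X) × (Fin n → X)) where
  toFun p := (fun k => if ε k then p.1 k else p.2 k, fun k => if ε k then p.2 k else p.1 k)
  invFun p := (fun k => if ε k then p.1 k else p.2 k, fun k => if ε k then p.2 k else p.1 k)
  left_inv p := by
    refine Prod.ext ?_ ?_ <;> funext k <;> cases h : ε k <;> simp [h]
  right_inv p := by
    refine Prod.ext ?_ ?_ <;> funext k <;> cases h : ε k <;> simp [h]

lemma expect_not_comp {n : ℕ} (F : (Fin n → Bool) → ℝ) :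
    𝔼 ε : Fin n → Bool, F (fun k => !ε k) = 𝔼 ε, F ε :=
  Fintype.expect_equiv (Equiv.piCongrRight fun _ => Equiv.boolNot) _ _ fun _ => rfl

lemma expect_iSup_le_expect_sub {ι X : Type*} [Nonempty ι] [Fintype X] [Nonempty X] {n : ℕ}
    {g : ι → X → ℝ} {B : ℝ} (hg : ∀ i x, |g i x| ≤ B) :
    𝔼 x : Fin n → X, ⨆ i, ∑ k, (g i (x k) - 𝔼 z, g i z)
      ≤ 𝔼 x : Fin n → X, 𝔼 y : Fin n → X, ⨆ i, ∑ k, (g i (x k) - g i (y k)) := by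
  refine expect_mono fun x => ciSup_le fun i => ?_
  have : ∑ k, (g i (x k) - 𝔼 z, g i z) = 𝔼 y : Fin n → X, ∑ k, (g i (x k) - g i (y k)) := by
    rw [Finset.expect_sum_comm]
    refine Finset.sum_congr rfl fun k _ => ?_
    rw [Finset.expect_sub_distrib, Fintype.expect_const, expect_apply_coord]
  rw [this]
  refine expect_mono fun y => ?_
  refine le_ciSup (f := fun i => ∑ k, (g i (x k) - g i (y k))) (BddFun.bddAbove ?_) i
  refine BddFun.sum _ fun k => ⟨B + B, fun i => ?_⟩
  exact (abs_sub _ _).trans (add_le_add (hg _ _) (hg _ _))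

/-- Symmetrization by Rademacher signs. -/
lemma symmetrization {ι X : Type*} [Nonempty ι] [Fintype X] [Nonempty X] {n : ℕ}
    {g : ι → X → ℝ} {B : ℝ} (hg : ∀ i x, |g i x| ≤ B) :
    𝔼 x : Fin n → X, ⨆ i, ∑ k, (g i (x k) - 𝔼 z, g i z)
      ≤ 2 * 𝔼 x : Fin n → X, 𝔼 ε : Fin n → Bool, ⨆ i, ∑ k, boolSign (ε k) * g i (x k) := by
  have hbdd : ∀ (ε : Fin n → Bool) (x : Fin n → X),
      BddFun fun i => ∑ k, boolSign (ε k) * g i (x k) := fun ε x =>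
    BddFun.sum _ fun k => BddFun.const_mul ⟨B, fun i => hg i _⟩ _
  have hswap : ∀ ε : Fin n → Bool,
      𝔼 x : Fin n → X, 𝔼 y : Fin n → X, ⨆ i, ∑ k, (g i (x k) - g i (y k))
        = 𝔼 x : Fin n → X, 𝔼 y : Fin n → X, ⨆ i, ∑ k, boolSign (ε k) * (g i (x k) - g i (y k)) := by
    intro ε
    rw [← Finset.expect_product', ← Finset.expect_product', Finset.univ_product_univ]
    refine (Fintype.expect_equiv (swapSamples ε) _ _ fun p => ?_).symm
    refine iSup_congr fun i => Finset.sum_congr rfl fun k _ => ?_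
    cases h : ε k <;> simp [swapSamples, h]
  have hsplit : ∀ (ε : Fin n → Bool) (x y : Fin n → X),
      ⨆ i, ∑ k, boolSign (ε k) * (g i (x k) - g i (y k))
        ≤ (⨆ i, ∑ k, boolSign (ε k) * g i (x k)) + ⨆ i, ∑ k, boolSign (!ε k) * g i (y k) := by
    intro ε x y
    refine ciSup_le fun i => ?_
    have h1 := le_ciSup (hbdd ε x).bddAbove i
    have h2 := le_ciSup (hbdd (fun k => !ε k) y).bddAbove i
    refine le_trans (le_of_eq ?_) (add_le_add h1 h2)
    rw [← Finset.sum_add_distrib]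
    refine Finset.sum_congr rfl fun k _ => ?_
    rw [boolSign_not]
    ring
  refine (expect_iSup_le_expect_sub hg).trans ?_
  calc _ = 𝔼 ε : Fin n → Bool, 𝔼 x : Fin n → X, 𝔼 y : Fin n → X,
          ⨆ i, ∑ k, boolSign (ε k) * (g i (x k) - g i (y k)) := by
        rw [← expect_congr_univ hswap, Fintype.expect_const]
    _ ≤ 𝔼 ε : Fin n → Bool, 𝔼 x : Fin n → X, 𝔼 y : Fin n → X,
          ((⨆ i, ∑ k, boolSign (ε k) * g i (x k)) + ⨆ i, ∑ k, boolSign (!ε k) * g i (y k)) :=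
        expect_mono fun ε => expect_mono fun x => expect_mono fun y => hsplit ε x y
    _ = _ := by
        simp only [Finset.expect_add_distrib, Fintype.expect_const]
        rw [expect_not_comp fun ε => 𝔼 y : Fin n → X, ⨆ i, ∑ k, boolSign (ε k) * g i (y k),
          Finset.expect_comm, two_mul]

open Classical in
/-- Uniform deviation of empirical sums over a class `g` which is a `2`-Lipschitz image of a class
`b` with Rademacher averages at most `R`. -/
lemma uniform_deviation {ι X : Type*} [Nonempty ι] [Fintype X] [Nonempty X] {n : ℕ} (hn : 0 < n)
    {g b : ι → X → ℝ} {B R u : ℝ} (hg : ∀ i x, |g i x| ≤ 1) (hb : ∀ i x, |b i x| ≤ B)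
    (hgb : ∀ i j x, |g i x - g j x| ≤ 2 * |b i x - b j x|)
    (hR : ∀ x : Fin n → X, 𝔼 ε : Fin n → Bool, ⨆ i, ∑ k, boolSign (ε k) * b i (x k) ≤ R)
    (hu : 0 ≤ u) :
    𝔼 x : Fin n → X,
      (if ∃ i, 4 * R + u ≤ ∑ k, (g i (x k) - 𝔼 z, g i z) then (1 : ℝ) else 0)
        ≤ Real.exp (-(u ^ 2 / (16 * n))) := by
  set F : (Fin n → X) → ℝ := fun x => ⨆ i, ∑ k, (g i (x k) - 𝔼 z, g i z) with hF
  have hFbdd : ∀ x : Fin n → X, BddAbove (range fun i => ∑ k, (g i (x k) - 𝔼 z, g i z)) := by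
    refine fun x => (BddFun.sum _ fun k => ⟨2, fun i => ?_⟩).bddAbove
    have h1 : |𝔼 z, g i z| ≤ 1 :=
      (Finset.abs_expect_le _ _).trans (Finset.expect_le Finset.univ_nonempty fun z _ => hg i z)
    linarith [abs_sub (g i (x k)) (𝔼 z, g i z), hg i (x k)]
  have hcontr : ∀ x : Fin n → X,
      𝔼 ε : Fin n → Bool, ⨆ i, ∑ k, boolSign (ε k) * g i (x k) ≤ 2 * R := by
    intro x
    have := rademacher_contraction (n := n) (h := fun _ : ι => (0 : ℝ))
      (a := fun k i => g i (x k) / 2) (b := fun k i => b i (x k)) ⟨0, by simp⟩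
      (fun k => ⟨1, fun i => ?_⟩) (fun k => ⟨B, fun i => hb _ _⟩) (fun k i j => ?_)
    · simp only [zero_add] at this
      have h2 : 𝔼 ε : Fin n → Bool, ⨆ i, ∑ k, boolSign (ε k) * g i (x k)
          = 2 * 𝔼 ε : Fin n → Bool, ⨆ i, ∑ k, boolSign (ε k) * (g i (x k) / 2) := by
        rw [Finset.mul_expect]
        refine expect_congr_univ fun ε => ?_
        rw [Real.mul_iSup_of_nonneg zero_le_two]
        refine iSup_congr fun i => ?_
        rw [Finset.mul_sum]
        exact Finset.sum_congr rfl fun k _ => by ring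
      rw [h2]
      linarith [hR x]
    · rw [abs_div, abs_two]
      linarith [hg i (x k), abs_nonneg (g i (x k))]
    · rw [← sub_div, abs_div, abs_two]
      linarith [hgb i j (x k)]
  have hmean : 𝔼 x, F x ≤ 4 * R := by
    refine (symmetrization hg).trans ?_
    have : 𝔼 x : Fin n → X, 𝔼 ε : Fin n → Bool, ⨆ i, ∑ k, boolSign (ε k) * g i (x k) ≤ 2 * R :=
      Finset.expect_le Finset.univ_nonempty fun x _ => hcontr x
    linarith
  have hdiff : ∀ x y k, (∀ l, l ≠ k → x l = y l) → F x - F y ≤ 2 := by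
    intro x y k hxy
    rw [sub_le_iff_le_add]
    refine ciSup_le fun i => ?_
    have h1 := le_ciSup (hFbdd y) i
    have h2 : ∑ k, (g i (x k) - 𝔼 z, g i z) - ∑ k, (g i (y k) - 𝔼 z, g i z)
        = g i (x k) - g i (y k) := by
      rw [← Finset.sum_sub_distrib, Finset.sum_eq_single k]
      · ring
      · intro l _ hl
        rw [hxy l hl, sub_self]
      · simp
    have h3 := (abs_le.1 (hg i (x k))).2
    have h4 := (abs_le.1 (hg i (y k))).1
    simp only [hF]
    linarith
  refine le_trans (expect_mono fun x => ?_) ((mcdiarmid hn two_pos hu hdiff).trans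
    (le_of_eq (by norm_num; ring)))
  split_ifs with h1 h2
  · exact le_rfl
  · obtain ⟨i, hi⟩ := h1
    have := le_ciSup (hFbdd x) i
    exact absurd (by simp only [hF] at hmean ⊢; linarith) h2
  · exact zero_le_one
  · exact le_rfl

lemma expect_exp_rademacher_le {n : ℕ} (w : Fin n → ℝ) :
    𝔼 ε : Fin n → Bool, Real.exp (∑ k, boolSign (ε k) * w k)
      ≤ Real.exp ((∑ k, w k ^ 2) / 2) := by
  induction n with
  | zero => simp
  | succ n ih =>
    rw [expect_cons]
    simp only [Fin.sum_univ_succ, Fin.cons_zero, Fin.cons_succ, Real.exp_add, add_div]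
    simp only [← Finset.expect_mul, ← Finset.mul_expect]
    have h1 : 𝔼 e, Real.exp (boolSign e * w 0) ≤ Real.exp (w 0 ^ 2 / 2) := by
      rw [expect_bool]
      simpa [Real.cosh_eq] using Real.cosh_le_exp_half_sq (w 0)
    exact mul_le_mul h1 (ih _) (Finset.expect_nonneg fun _ _ => Real.exp_nonneg _)
      (Real.exp_nonneg _)

lemma expect_rademacher_mul {n : ℕ} (u v : Fin n → ℝ) :
    𝔼 ε : Fin n → Bool, ((∑ k, boolSign (ε k) * u k) * ∑ k, boolSign (ε k) * v k)
      = ∑ k, u k * v k := by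
  induction n with
  | zero => simp
  | succ n ih =>
    rw [expect_cons]
    simp only [Fin.sum_univ_succ, Fin.cons_zero, Fin.cons_succ]
    rw [← ih, ← Fintype.expect_const (ι := Fin n → Bool) (u 0 * v 0),
      ← Finset.expect_add_distrib]
    refine expect_congr_univ fun y => ?_
    rw [expect_bool, boolSign_true, boolSign_false]
    ring

/-- Massart's finite class bound, through an explicit majorant of the maximum. -/
lemma exists_rademacher_majorant {J : Type*} [Fintype J] {n : ℕ} (hn : 0 < n)
    {a : J → Fin n → ℝ} (ha : ∀ j k, |a j k| ≤ 1) {L : ℝ} (hL : 0 < L)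
    (hJ : (Fintype.card J : ℝ) ≤ Real.exp L) :
    ∃ W : (Fin n → Bool) → ℝ, (∀ ε j, ∑ k, boolSign (ε k) * a j k ≤ W ε) ∧
      𝔼 ε, W ε ≤ 2 * √(n * L) := by
  have hn' : (0 : ℝ) < n := by exact_mod_cast hn
  set l := √(L / n) with hl
  have hl0 : 0 < l := Real.sqrt_pos.2 (by positivity)
  have hl2 : l ^ 2 * n = L := by
    rw [hl, Real.sq_sqrt (by positivity)]
    field_simp
  set A := 3 / 2 * L with hA
  set S : (Fin n → Bool) → J → ℝ := fun ε j => ∑ k, boolSign (ε k) * (l * a j k) with hS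
  have hSl : ∀ ε j, S ε j = l * ∑ k, boolSign (ε k) * a j k := fun ε j => by
    rw [hS, Finset.mul_sum]
    exact Finset.sum_congr rfl fun k _ => by ring
  refine ⟨fun ε => (A - 1 + Real.exp (-A) * ∑ j, Real.exp (S ε j)) / l, fun ε j => ?_, ?_⟩
  · rw [le_div_iff₀ hl0, mul_comm, ← hSl]
    have h1 := Real.add_one_le_exp (S ε j - A)
    have h2 : Real.exp (S ε j - A) ≤ Real.exp (-A) * ∑ j, Real.exp (S ε j) := by
      rw [sub_eq_neg_add, Real.exp_add]
      refine mul_le_mul_of_nonneg_left ?_ (Real.exp_nonneg _)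
      exact Finset.single_le_sum (f := fun j => Real.exp (S ε j))
        (fun _ _ => Real.exp_nonneg _) (Finset.mem_univ j)
    linarith
  · have hj : ∀ j, 𝔼 ε, Real.exp (S ε j) ≤ Real.exp (L / 2) := by
      intro j
      refine (expect_exp_rademacher_le _).trans (Real.exp_le_exp.2 ?_)
      refine div_le_div_of_nonneg_right ?_ zero_le_two
      calc ∑ k, (l * a j k) ^ 2 ≤ ∑ _k : Fin n, l ^ 2 := by
            refine Finset.sum_le_sum fun k _ => ?_
            rw [mul_pow]
            exact mul_le_of_le_one_right (sq_nonneg _) ((sq_le_one_iff_abs_le_one _).2 (ha j k))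
        _ = L := by simp [← hl2, mul_comm]
    have hsum : Real.exp (-A) * 𝔼 ε, ∑ j, Real.exp (S ε j) ≤ 1 := by
      calc _ ≤ Real.exp (-A) * (Real.exp L * Real.exp (L / 2)) := by
            refine mul_le_mul_of_nonneg_left ?_ (Real.exp_nonneg _)
            rw [Finset.expect_sum_comm]
            refine (Finset.sum_le_sum fun j _ => hj j).trans ?_
            rw [Finset.sum_const, nsmul_eq_mul, Finset.card_univ]
            exact mul_le_mul_of_nonneg_right hJ (Real.exp_nonneg _)
        _ = 1 := by
            rw [← Real.exp_add, ← Real.exp_add, Real.exp_eq_one_iff]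
            ring
    rw [← Finset.expect_div, Finset.expect_add_distrib, Fintype.expect_const, ← Finset.mul_expect,
      div_le_iff₀ hl0, hl, mul_assoc, ← Real.sqrt_mul (by positivity)]
    have : √(n * L * (L / n)) = L := by
      rw [show (n * L * (L / n) : ℝ) = L ^ 2 by field_simp, Real.sqrt_sq hL.le]
    rw [this]
    linarith

lemma sq_le_add_exp {L : ℝ} (hL : 0 < L) (x : ℝ) :
    x ^ 2 ≤ 4 * L + (4 + 2 / L) *
      (Real.exp (-(2 * L)) * (Real.exp (√L * x) + Real.exp (-(√L * x)))) := by
  have hs : √L ^ 2 = L := Real.sq_sqrt hL.le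
  have hpos : ∀ y, x ^ 2 = y ^ 2 → √L * y - 2 * L ≤ 0 ∨ x ^ 2 ≤ 4 * L + (4 + 2 / L) *
      (Real.exp (-(2 * L)) * Real.exp (√L * y)) := by
    intro y hy
    rcases le_or_gt (√L * y - 2 * L) 0 with h | h
    · exact Or.inl h
    · right
      have h1 := Real.quadratic_le_exp_of_nonneg h.le
      rw [← Real.exp_add, neg_add_eq_sub, hy]
      set z := √L * y - 2 * L with hz
      have hy2 : y ^ 2 = 4 * L + 4 * z + z ^ 2 / L := by
        have : y ^ 2 * L = (z + 2 * L) ^ 2 := by rw [hz, sub_add_cancel, mul_pow, hs, mul_comm]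
        field_simp
        linarith
      have h2 : z ≤ Real.exp z := by nlinarith
      have h3 : z ^ 2 / L ≤ 2 / L * Real.exp z := by
        rw [div_mul_eq_mul_div]
        exact div_le_div_of_nonneg_right (by nlinarith) hL.le
      rw [hy2]
      linarith
  have hc : 0 ≤ (4 + 2 / L) := by positivity
  have hfin : ∀ p : ℝ, 0 ≤ (4 + 2 / L) * (Real.exp (-(2 * L)) * Real.exp p) :=
    fun p => by positivity
  have e1 := hfin (√L * x)
  have e2 := hfin (-(√L * x))
  rw [mul_add, mul_add]
  rcases hpos x rfl with h | h
  · rcases hpos (-x) (by ring) with h' | h'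
    · have : (√L * x) ^ 2 ≤ (2 * L) ^ 2 := sq_le_sq' (by linarith) (by linarith)
      rw [mul_pow, hs] at this
      have : x ^ 2 ≤ 4 * L := by
        by_contra hcon
        nlinarith
      linarith
    · rw [mul_neg] at h'
      linarith
  · linarith

lemma exists_sq_majorant {J : Type*} [Fintype J] {n : ℕ} {w : J → Fin n → ℝ}
    (hw : ∀ j, ∑ k, w j k ^ 2 ≤ 1) {L : ℝ} (hL : 1 / 2 ≤ L)
    (hJ : (Fintype.card J : ℝ) ≤ Real.exp L) :
    ∃ Q : (Fin n → Bool) → ℝ, (∀ σ j, (∑ k, boolSign (σ k) * w j k) ^ 2 ≤ Q σ) ∧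
      𝔼 σ, Q σ ≤ 36 * L := by
  have hL0 : 0 < L := by linarith
  set c := 4 + 2 / L with hc
  have hc0 : 0 ≤ c := by positivity
  set S : (Fin n → Bool) → J → ℝ := fun σ j => ∑ k, boolSign (σ k) * w j k with hS
  set E : (Fin n → Bool) → J → ℝ :=
    fun σ j => Real.exp (√L * S σ j) + Real.exp (-(√L * S σ j)) with hE
  refine ⟨fun σ => 4 * L + c * (Real.exp (-(2 * L)) * ∑ j, E σ j), fun σ j => ?_, ?_⟩
  · refine (sq_le_add_exp hL0 _).trans ?_
    have : E σ j ≤ ∑ j, E σ j := Finset.single_le_sum (f := E σ)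
      (fun j _ => by simp only [hE]; positivity) (Finset.mem_univ j)
    have := mul_le_mul_of_nonneg_left
      (mul_le_mul_of_nonneg_left this (Real.exp_nonneg (-(2 * L)))) hc0
    simp only [hE, hS] at this ⊢
    linarith
  · have hone : ∀ t : ℝ, t ^ 2 = L → ∀ j, 𝔼 σ, Real.exp (t * S σ j) ≤ Real.exp (L / 2) := by
      intro t ht j
      have h1 : ∀ σ, t * S σ j = ∑ k, boolSign (σ k) * (t * w j k) := fun σ => by
        rw [hS, Finset.mul_sum]
        exact Finset.sum_congr rfl fun k _ => by ring
      simp only [h1]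
      refine (expect_exp_rademacher_le _).trans (Real.exp_le_exp.2 ?_)
      refine div_le_div_of_nonneg_right ?_ zero_le_two
      simp only [mul_pow, ht, ← Finset.mul_sum]
      exact mul_le_of_le_one_right hL0.le (hw j)
    have hj : ∀ j, 𝔼 σ, E σ j ≤ 2 * Real.exp (L / 2) := by
      intro j
      simp only [hE, Finset.expect_add_distrib, ← neg_mul]
      have h1 := hone (√L) (Real.sq_sqrt hL0.le) j
      have h2 := hone (-√L) (by rw [neg_sq, Real.sq_sqrt hL0.le]) j
      linarith
    have hsum : Real.exp (-(2 * L)) * 𝔼 σ, ∑ j, E σ j ≤ 2 := by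
      calc _ ≤ Real.exp (-(2 * L)) * (Real.exp L * (2 * Real.exp (L / 2))) := by
            refine mul_le_mul_of_nonneg_left ?_ (Real.exp_nonneg _)
            rw [Finset.expect_sum_comm]
            refine (Finset.sum_le_sum fun j _ => hj j).trans ?_
            rw [Finset.sum_const, nsmul_eq_mul, Finset.card_univ]
            exact mul_le_mul_of_nonneg_right hJ (by positivity)
        _ = 2 * Real.exp (-(L / 2)) := by
            rw [mul_left_comm (Real.exp L), mul_left_comm, ← Real.exp_add, ← Real.exp_add]
            congr 2
            ring
        _ ≤ 2 := by
            have : Real.exp (-(L / 2)) ≤ 1 := Real.exp_le_one_iff.2 (by linarith)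
            linarith
    rw [Finset.expect_add_distrib, Fintype.expect_const, ← Finset.mul_expect, ← Finset.mul_expect]
    have h1 := mul_le_mul_of_nonneg_left hsum hc0
    have h2 : 2 / L ≤ 4 := by rw [div_le_iff₀ hL0]; linarith
    linarith

/-- A linear form on a cube is dominated by its value at a vertex. -/
lemma exists_sign_le {I : Type*} [Fintype I] [DecidableEq I] {n : ℕ} (p : Fin n → I)
    (c : Fin n → ℝ) {a : I → ℝ} {α : ℝ} (ha : ∀ i, |a i| ≤ α) :
    ∃ s : I → Bool, ∑ k, c k * a (p k) ≤ α * ∑ k, c k * boolSign (s (p k)) := by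
  set C : I → ℝ := fun i => ∑ k with p k = i, c k with hC
  have hfib : ∀ f : I → ℝ, ∑ k, c k * f (p k) = ∑ i, C i * f i := by
    intro f
    rw [← Finset.sum_fiberwise Finset.univ p]
    refine Finset.sum_congr rfl fun i _ => ?_
    rw [hC, Finset.sum_mul]
    refine Finset.sum_congr rfl fun k hk => ?_
    rw [(Finset.mem_filter.1 hk).2]
  refine ⟨fun i => decide (0 ≤ C i), ?_⟩
  rw [hfib, hfib (fun i => boolSign (decide (0 ≤ C i))), Finset.mul_sum]
  refine Finset.sum_le_sum fun i _ => ?_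
  have h1 : C i * boolSign (decide (0 ≤ C i)) = |C i| := by
    rcases le_or_gt 0 (C i) with h | h
    · simp [h, abs_of_nonneg h]
    · simp [not_le.2 h, abs_of_neg h]
  rw [h1]
  calc C i * a i ≤ |C i * a i| := le_abs_self _
    _ = |a i| * |C i| := by rw [abs_mul, mul_comm]
    _ ≤ α * |C i| := mul_le_mul_of_nonneg_right (ha i) (abs_nonneg _)

lemma exists_signs_le {I J : Type*} [Fintype I] [DecidableEq I] [Fintype J] [DecidableEq J]
    {n : ℕ} (x : Fin n → I × J) (c : Fin n → ℝ) {a : I → ℝ} {b : J → ℝ} {α β : ℝ} (hα : 0 ≤ α)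
    (ha : ∀ i, |a i| ≤ α) (hb : ∀ j, |b j| ≤ β) :
    ∃ (s : I → Bool) (t : J → Bool), ∑ k, c k * (a (x k).1 * b (x k).2)
      ≤ α * β * ∑ k, c k * (boolSign (s (x k).1) * boolSign (t (x k).2)) := by
  obtain ⟨s, hs⟩ := exists_sign_le (fun k => (x k).1) (fun k => c k * b (x k).2) ha
  obtain ⟨t, ht⟩ := exists_sign_le (fun k => (x k).2) (fun k => c k * boolSign (s (x k).1)) hb
  refine ⟨s, t, ?_⟩
  calc _ = ∑ k, c k * b (x k).2 * a (x k).1 := Finset.sum_congr rfl fun k _ => by ring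
    _ ≤ α * ∑ k, c k * boolSign (s (x k).1) * b (x k).2 := by
        refine hs.trans (le_of_eq ?_)
        congr 1
        exact Finset.sum_congr rfl fun k _ => by ring
    _ ≤ α * (β * ∑ k, c k * boolSign (s (x k).1) * boolSign (t (x k).2)) :=
        mul_le_mul_of_nonneg_left ht hα
    _ = _ := by
        rw [mul_assoc]
        congr 2
        exact Finset.sum_congr rfl fun k _ => by ring

lemma half_le_log {x : ℝ} (hx : 2 ≤ x) : 1 / 2 ≤ Real.log x := by
  have := Real.log_le_log two_pos hx
  linarith [Real.log_two_gt_d9]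

/-- Duality between the `∞ → 1` norm and the max-norm, up to a logarithm. -/
lemma sum_mul_factored_le {d1 d2 d n : ℕ} (hd1 : 0 < d1) (hd2 : 0 < d2)
    {U : Matrix (Fin d1) (Fin d) ℝ} {V : Matrix (Fin d2) (Fin d) ℝ}
    (hU : ∀ i, ∑ l, U i l ^ 2 ≤ 1) (hV : ∀ j, ∑ l, V j l ^ 2 ≤ 1)
    (x : Fin n → Fin d1 × Fin d2) (c : Fin n → ℝ) {W : ℝ}
    (hW : ∀ (s : Fin d1 → Bool) (t : Fin d2 → Bool),
      ∑ k, c k * (boolSign (s (x k).1) * boolSign (t (x k).2)) ≤ W) :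
    ∑ k, c k * (U * Vᵀ) (x k).1 (x k).2 ≤ 36 * Real.log (d1 + d2) * W := by
  have hd : (2 : ℝ) ≤ d1 + d2 := by
    have : (2 : ℕ) ≤ d1 + d2 := by omega
    exact_mod_cast this
  have hW0 : 0 ≤ W := by
    obtain ⟨s, t, hst⟩ := exists_signs_le x c (a := fun _ => 0) (b := fun _ => 0)
      zero_le_one (by simp) (by simp) (β := 1)
    exact le_trans (by simpa using hst) (hW s t)
  obtain ⟨Q, hQ, hQE⟩ := exists_sq_majorant (J := Fin d1 ⊕ Fin d2)
    (w := Sum.elim (fun i => U i) (fun j => V j)) (L := Real.log (d1 + d2))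
    (by rintro (i | j); exacts [hU i, hV j]) (half_le_log hd)
    (by rw [Real.exp_log (by linarith)]; simp)
  have hQ0 : ∀ σ, 0 ≤ Q σ := fun σ => (sq_nonneg _).trans (hQ σ (Sum.inl ⟨0, hd1⟩))
  calc ∑ k, c k * (U * Vᵀ) (x k).1 (x k).2
      = 𝔼 σ : Fin d → Bool, ∑ k, c k * ((∑ l, boolSign (σ l) * U (x k).1 l) *
          ∑ l, boolSign (σ l) * V (x k).2 l) := by
        rw [Finset.expect_sum_comm]
        refine Finset.sum_congr rfl fun k _ => ?_
        rw [← Finset.mul_expect, expect_rademacher_mul]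
        rfl
    _ ≤ 𝔼 σ, Q σ * W := by
        refine expect_mono fun σ => ?_
        obtain ⟨s, t, hst⟩ := exists_signs_le x c
          (a := fun i => ∑ l, boolSign (σ l) * U i l) (b := fun j => ∑ l, boolSign (σ l) * V j l)
          (Real.sqrt_nonneg (Q σ)) (fun i => Real.abs_le_sqrt (hQ σ (Sum.inl i)))
          (fun j => Real.abs_le_sqrt (hQ σ (Sum.inr j)))
        rw [Real.mul_self_sqrt (hQ0 σ)] at hst
        exact hst.trans (mul_le_mul_of_nonneg_left (hW s t) (hQ0 σ))
    _ ≤ _ := by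
        rw [← Finset.expect_mul]
        exact mul_le_mul_of_nonneg_right hQE hW0

lemma sum_sq_le_norm12_sq {m d : ℕ} (U : Matrix (Fin m) (Fin d) ℝ) (i : Fin m) :
    ∑ l, U i l ^ 2 ≤ norm12 Uᵀ ^ 2 := by
  have h : √(∑ l, U i l ^ 2) ≤ norm12 Uᵀ :=
    le_ciSup (f := fun i => √(∑ l, Uᵀ l i ^ 2)) (Set.finite_range _).bddAbove i
  exact (Real.sqrt_le_left ((Real.sqrt_nonneg _).trans h)).1 h

lemma norm12_nonneg {m d : ℕ} (U : Matrix (Fin m) (Fin d) ℝ) : 0 ≤ norm12 U :=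
  Real.iSup_nonneg fun _ => Real.sqrt_nonneg _

/-- A matrix of max-norm less than `c` is `c` times a product with rows in the unit ball. -/
lemma exists_factored_of_maxNorm_lt {d1 d2 : ℕ} {M : Matrix (Fin d1) (Fin d2) ℝ} {c : ℝ}
    (hc : 0 < c) (hM : maxNorm M < c) :
    ∃ (d : ℕ) (U : Matrix (Fin d1) (Fin d) ℝ) (V : Matrix (Fin d2) (Fin d) ℝ),
      (∀ i, ∑ l, U i l ^ 2 ≤ 1) ∧ (∀ j, ∑ l, V j l ^ 2 ≤ 1) ∧ M = c • (U * Vᵀ) := by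
  have hne : {c | ∃ (d : ℕ) (U : Matrix (Fin d1) (Fin d) ℝ) (V : Matrix (Fin d2) (Fin d) ℝ),
      M = U * Vᵀ ∧ c = norm12 Uᵀ * norm12 Vᵀ}.Nonempty := ⟨_, d2, M, 1, by simp, rfl⟩
  obtain ⟨_, ⟨d, U, V, hUV, rfl⟩, hlt⟩ := exists_lt_of_csInf_lt hne hM
  rcases (norm12_nonneg Uᵀ).eq_or_lt with h0 | hpos
  · refine ⟨0, 0, 0, by simp, by simp, ?_⟩
    have hU0 : U = 0 := by
      ext i l
      have h1 := sum_sq_le_norm12_sq U i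
      rw [← h0] at h1
      have h2 : U i l ^ 2 ≤ ∑ l, U i l ^ 2 :=
        Finset.single_le_sum (f := fun l => U i l ^ 2) (fun _ _ => sq_nonneg _)
          (Finset.mem_univ l)
      exact pow_eq_zero_iff two_ne_zero |>.1 (le_antisymm (by linarith) (sq_nonneg _))
    simp [hUV, hU0]
  · set ρ := norm12 Uᵀ with hρ
    refine ⟨d, ρ⁻¹ • U, (ρ / c) • V, fun i => ?_, fun j => ?_, ?_⟩
    · simp only [Matrix.smul_apply, smul_eq_mul, mul_pow, ← Finset.mul_sum]
      rw [inv_pow, inv_mul_le_iff₀ (by positivity), mul_one]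
      exact sum_sq_le_norm12_sq U i
    · simp only [Matrix.smul_apply, smul_eq_mul, mul_pow, ← Finset.mul_sum]
      calc (ρ / c) ^ 2 * ∑ l, V j l ^ 2 ≤ (ρ / c) ^ 2 * norm12 Vᵀ ^ 2 :=
            mul_le_mul_of_nonneg_left (sum_sq_le_norm12_sq V j) (sq_nonneg _)
        _ = (ρ * norm12 Vᵀ / c) ^ 2 := by ring
        _ ≤ 1 := by
            refine pow_le_one₀ (div_nonneg (mul_nonneg hpos.le (norm12_nonneg _)) hc.le) ?_
            rw [div_le_one hc]
            exact hlt.le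
    · rw [hUV, Matrix.transpose_smul, Matrix.smul_mul, Matrix.mul_smul, smul_smul, smul_smul]
      rw [show c * ρ⁻¹ * (ρ / c) = 1 by field_simp, one_smul]

lemma abs_le_entrySup {d1 d2 : ℕ} (M : Matrix (Fin d1) (Fin d2) ℝ) (i : Fin d1) (j : Fin d2) :
    |M i j| ≤ entrySup M :=
  (le_ciSup (f := fun j => |M i j|) (Set.finite_range _).bddAbove j).trans
    (le_ciSup (f := fun i => ⨆ j, |M i j|) (Set.finite_range _).bddAbove i)

/-- Matrices with entries in `[-1, 1]` which are `c` times a product with rows in the unit ball. -/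
def factoredBall (d1 d2 : ℕ) (c : ℝ) : Set (Matrix (Fin d1) (Fin d2) ℝ) :=
  {M | (∀ i j, |M i j| ≤ 1) ∧
    ∃ (d : ℕ) (U : Matrix (Fin d1) (Fin d) ℝ) (V : Matrix (Fin d2) (Fin d) ℝ),
      (∀ i, ∑ l, U i l ^ 2 ≤ 1) ∧ (∀ j, ∑ l, V j l ^ 2 ≤ 1) ∧ M = c • (U * Vᵀ)}

lemma mem_factoredBall_of_tripleNormMC_le {d1 d2 r : ℕ} (hr : 0 < r)
    {M : Matrix (Fin d1) (Fin d2) ℝ} (hM : tripleNormMC r M ≤ 1) :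
    M ∈ factoredBall d1 d2 (2 * √r) := by
  have hr' : 0 < √(r : ℝ) := Real.sqrt_pos.2 (by exact_mod_cast hr)
  obtain ⟨h1, h2⟩ := max_le_iff.1 hM
  refine ⟨fun i j => (abs_le_entrySup M i j).trans h1,
    exists_factored_of_maxNorm_lt (by positivity) ?_⟩
  rw [div_le_one hr'] at h2
  linarith

lemma factoredBall_nonempty (d1 d2 : ℕ) (c : ℝ) : (factoredBall d1 d2 c).Nonempty :=
  ⟨0, by simp, 0, 0, 0, by simp, by simp, by simp⟩

lemma expect_iSup_factoredBall_le {d1 d2 n : ℕ} (hd1 : 0 < d1) (hd2 : 0 < d2) (hn : 0 < n)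
    {c : ℝ} (hc : 0 ≤ c) (x : Fin n → Fin d1 × Fin d2) :
    𝔼 ε : Fin n → Bool, ⨆ M : factoredBall d1 d2 c,
        ∑ k, boolSign (ε k) * M.1 (x k).1 (x k).2
      ≤ c * (36 * Real.log (d1 + d2) * (2 * √(n * (d1 + d2)))) := by
  have := (factoredBall_nonempty d1 d2 c).to_subtype
  have hd : (1 : ℝ) ≤ d1 + d2 := by
    have : (1 : ℕ) ≤ d1 + d2 := by omega
    exact_mod_cast this
  obtain ⟨W, hW, hWE⟩ := exists_rademacher_majorant hn
    (J := (Fin d1 → Bool) × (Fin d2 → Bool))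
    (a := fun p k => boolSign (p.1 (x k).1) * boolSign (p.2 (x k).2)) (L := d1 + d2)
    (fun p k => by
      cases p.1 (x k).1 <;> cases p.2 (x k).2 <;> simp) (by linarith)
    (by
      have h2 : (2 : ℝ) ≤ Real.exp 1 := by linarith [Real.add_one_le_exp 1]
      have h3 := pow_le_pow_left₀ zero_le_two h2 (d1 + d2)
      rw [← Real.exp_nat_mul] at h3
      push_cast at h3
      rw [mul_one] at h3
      simpa [← pow_add] using h3)
  have hL : 0 ≤ Real.log (d1 + d2) := Real.log_nonneg hd
  calc _ ≤ 𝔼 ε, c * (36 * Real.log (d1 + d2) * W ε) := by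
        refine expect_mono fun ε => ciSup_le ?_
        rintro ⟨M, _, d, U, V, hU, hV, hM⟩
        have := sum_mul_factored_le hd1 hd2 hU hV x (fun k => boolSign (ε k))
          (fun s t => hW ε (s, t))
        refine le_trans (le_of_eq ?_) (mul_le_mul_of_nonneg_left this hc)
        rw [Finset.mul_sum]
        refine Finset.sum_congr rfl fun k _ => ?_
        simp only [hM, Matrix.smul_apply, smul_eq_mul]
        ring
    _ ≤ _ := by
        rw [← Finset.mul_expect, ← Finset.mul_expect]
        gcongr

open Classical in
/-- One-sided uniform deviation of the empirical mean of squared entries. -/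
lemma factoredBall_deviation {d1 d2 n : ℕ} (hd1 : 0 < d1) (hd2 : 0 < d2) (hn : 0 < n)
    {c u s : ℝ} (hc : 0 ≤ c) (hu : 0 ≤ u) (hs : |s| = 1) :
    𝔼 x : Fin n → Fin d1 × Fin d2,
      (if ∃ M ∈ factoredBall d1 d2 c,
          4 * (c * (36 * Real.log (d1 + d2) * (2 * √(n * (d1 + d2))))) + u
            ≤ s * (∑ k, M (x k).1 (x k).2 ^ 2 - n * 𝔼 z : Fin d1 × Fin d2, M z.1 z.2 ^ 2)
        then (1 : ℝ) else 0) ≤ Real.exp (-(u ^ 2 / (16 * n))) := by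
  have := (factoredBall_nonempty d1 d2 c).to_subtype
  have : Nonempty (Fin d1 × Fin d2) := ⟨(⟨0, hd1⟩, ⟨0, hd2⟩)⟩
  have key := uniform_deviation hn
    (g := fun (M : factoredBall d1 d2 c) (z : Fin d1 × Fin d2) => s * M.1 z.1 z.2 ^ 2)
    (b := fun M z => M.1 z.1 z.2) (B := 1)
    (fun M z => by
      rw [abs_mul, hs, one_mul, abs_pow]
      exact pow_le_one₀ (abs_nonneg _) (M.2.1 _ _))
    (fun M z => M.2.1 _ _)
    (fun M N z => by
      rw [← mul_sub, abs_mul, hs, one_mul, sq_sub_sq, abs_mul]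
      refine mul_le_mul_of_nonneg_right ?_ (abs_nonneg _)
      linarith [abs_add_le (M.1 z.1 z.2) (N.1 z.1 z.2), M.2.1 z.1 z.2, N.2.1 z.1 z.2])
    (expect_iSup_factoredBall_le hd1 hd2 hn hc) hu
  refine le_trans (le_of_eq (expect_congr_univ fun x => ?_)) key
  refine if_congr ?_ rfl rfl
  have hsum : ∀ M : Matrix (Fin d1) (Fin d2) ℝ,
      ∑ k, (s * M (x k).1 (x k).2 ^ 2 - 𝔼 z : Fin d1 × Fin d2, s * M z.1 z.2 ^ 2)
        = s * (∑ k, M (x k).1 (x k).2 ^ 2 - n * 𝔼 z : Fin d1 × Fin d2, M z.1 z.2 ^ 2) := by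
    intro M
    rw [Finset.sum_sub_distrib, ← Finset.mul_sum, ← Finset.mul_expect]
    simp
    ring
  constructor
  · rintro ⟨M, hM, h⟩
    exact ⟨⟨M, hM⟩, by rwa [hsum M]⟩
  · rintro ⟨M, h⟩
    exact ⟨M.1, M.2, by rwa [hsum M.1] at h⟩

lemma pi_uniform_apply {X : Type*} [Fintype X] [Nonempty X] [MeasurableSpace X]
    [MeasurableSingletonClass X] {n : ℕ} (s : Set (Fin n → X)) [DecidablePred (· ∈ s)] :
    Measure.pi (fun _ : Fin n => ((Fintype.card X : ℝ≥0∞))⁻¹ • Measure.count) s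
      = ENNReal.ofReal (𝔼 x : Fin n → X, if x ∈ s then (1 : ℝ) else 0) := by
  have hcard : (0 : ℝ) < Fintype.card X := by exact_mod_cast Fintype.card_pos
  have : IsFiniteMeasure (((Fintype.card X : ℝ≥0∞))⁻¹ • (Measure.count : Measure X)) :=
    Measure.smul_finite _ (by simp)
  have hs : s = ((Finset.univ.filter (· ∈ s) : Finset (Fin n → X)) : Set (Fin n → X)) := by
    ext; simp
  rw [Fintype.expect_eq_sum_div_card, Finset.sum_boole]
  conv_lhs => rw [hs, ← sum_measure_singleton]
  have h1 : ∀ x : Fin n → X,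
      Measure.pi (fun _ : Fin n => ((Fintype.card X : ℝ≥0∞))⁻¹ • Measure.count) {x}
        = ENNReal.ofReal (((Fintype.card X : ℝ) ^ n)⁻¹) := by
    intro x
    rw [Measure.pi_singleton]
    simp only [Measure.smul_apply, Measure.count_singleton, smul_eq_mul, mul_one,
      Finset.prod_const, Finset.card_univ, Fintype.card_fin]
    rw [ENNReal.ofReal_inv_of_pos (pow_pos hcard n), ENNReal.ofReal_pow hcard.le,
      ENNReal.ofReal_natCast, ENNReal.inv_pow]
  rw [Finset.sum_congr rfl fun x _ => h1 x, Finset.sum_const, nsmul_eq_mul]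
  rw [div_eq_mul_inv, ENNReal.ofReal_mul (Nat.cast_nonneg _)]
  simp

lemma expect_sq_eq_frobNorm_sq_div {d1 d2 : ℕ} (M : Matrix (Fin d1) (Fin d2) ℝ) :
    𝔼 z : Fin d1 × Fin d2, M z.1 z.2 ^ 2 = frobNorm M ^ 2 / (d1 * d2) := by
  rw [frobNorm, Real.sq_sqrt (by positivity), Fintype.expect_eq_sum_div_card,
    Fintype.sum_prod_type]
  simp

lemma deviation_threshold_le {r d n L T ζ : ℝ} (hr : 1 ≤ r) (hd : 2 ≤ d) (hn : 0 < n)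
    (hL : 1 / 2 ≤ L) (hζ : 0 < ζ) (hT : T = max (r * d * L ^ 3) (Real.log (1 / ζ) ^ 2)) :
    4 * (2 * √r * (36 * L * (2 * √(n * d)))) + √(16 * n * Real.log (2 / ζ)) ≤ 1000 * √(T * n) := by
  have hrd : 2 ≤ r * d := by nlinarith
  have hL3 : (1 / 8 : ℝ) ≤ L ^ 3 := by
    have := pow_le_pow_left₀ (by norm_num) hL 3
    norm_num at this ⊢
    linarith
  have h1 : r * d * L ^ 3 ≤ T := hT ▸ le_max_left _ _
  have h2 : Real.log (1 / ζ) ^ 2 ≤ T := hT ▸ le_max_right _ _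
  have hT4 : 1 / 4 ≤ T := by nlinarith
  have h3 : r * d * L ^ 2 ≤ 2 * T := by
    have : r * d * L ^ 2 ≤ 2 * (r * d * L ^ 3) := by
      have h0 : 0 ≤ r * d * L ^ 2 := by positivity
      nlinarith
    linarith
  have hTn : 0 ≤ T * n := by positivity
  have e1 : √r * (L * √(n * d)) ≤ 3 / 2 * √(T * n) := by
    have hsq : (√r * (L * √(n * d))) ^ 2 ≤ (3 / 2 * √(T * n)) ^ 2 := by
      rw [mul_pow, mul_pow, mul_pow, Real.sq_sqrt (by linarith), Real.sq_sqrt (by positivity),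
        Real.sq_sqrt hTn]
      nlinarith
    exact (pow_le_pow_iff_left₀ (by positivity) (by positivity) two_ne_zero).1 hsq
  have hlog : Real.log (2 / ζ) ≤ 9 * T := by
    rw [Real.log_div two_ne_zero hζ.ne']
    rw [Real.log_div one_ne_zero hζ.ne', Real.log_one, zero_sub] at h2
    nlinarith [Real.log_two_lt_d9, sq_nonneg (-Real.log ζ - 1)]
  have e2 : √(16 * n * Real.log (2 / ζ)) ≤ 12 * √(T * n) := by
    rw [Real.sqrt_le_left (by positivity), mul_pow, Real.sq_sqrt hTn]
    nlinarith
  nlinarith [Real.sqrt_nonneg (T * n)]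

theorem stmt_16 :
    ∃ C : ℝ, 0 < C ∧
    ∀ (d1 d2 n r : ℕ), 0 < d1 → 0 < d2 → 0 < n → 0 < r →
    ∀ (Ω : Type) (_ : MeasureSpace Ω) (_ : IsProbabilityMeasure (ℙ : Measure Ω))
      (idx : Fin n → Ω → Fin d1 × Fin d2),
    -- (i_k, j_k) i.i.d. uniform on [d1] × [d2]
    Measure.map (fun ω k => idx k ω) ℙ
      = Measure.pi (fun _ : Fin n =>
          ((Fintype.card (Fin d1 × Fin d2) : ℝ≥0∞))⁻¹ • Measure.count) →
    ∀ ζ : ℝ, ζ ∈ Set.Ioo (0:ℝ) 1 →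
    (1 : ℝ≥0∞) - ENNReal.ofReal ζ ≤
      ℙ {ω : Ω | ∀ M : Matrix (Fin d1) (Fin d2) ℝ, tripleNormMC r M ≤ 1 →
        |((d1 * d2 : ℝ) / n) * (∑ k : Fin n, (M (idx k ω).1 (idx k ω).2)^2)
            - (frobNorm M)^2|
          ≤ C * d1 * d2 *
            max ((max ((r:ℝ) * (d1 + d2) * (Real.log (d1 + d2))^3) ((Real.log (1/ζ))^2)) / n)
              (Real.sqrt
                ((max ((r:ℝ) * (d1 + d2) * (Real.log (d1 + d2))^3) ((Real.log (1/ζ))^2)) / n))} := by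
  refine ⟨1000, by norm_num, ?_⟩
  intro d1 d2 n r hd1 hd2 hn hr Ω _ _ idx hmap ζ hζ
  classical
  set T := max ((r:ℝ) * (d1 + d2) * (Real.log (d1 + d2))^3) ((Real.log (1/ζ))^2) with hT
  have : Nonempty (Fin d1 × Fin d2) := ⟨(⟨0, hd1⟩, ⟨0, hd2⟩)⟩
  have hn' : (0 : ℝ) < n := by exact_mod_cast hn
  have hd1' : (0 : ℝ) < d1 := by exact_mod_cast hd1
  have hd2' : (0 : ℝ) < d2 := by exact_mod_cast hd2
  have hr' : (1 : ℝ) ≤ r := by exact_mod_cast hr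
  have hd : (2 : ℝ) ≤ d1 + d2 := by
    have : (2 : ℕ) ≤ d1 + d2 := by omega
    exact_mod_cast this
  set u := √(16 * n * Real.log (2 / ζ)) with hu
  set v := 4 * (2 * √r * (36 * Real.log (d1 + d2) * (2 * √(n * (d1 + d2))))) + u with hv
  have hvT : v ≤ 1000 * √(T * n) := deviation_threshold_le hr' hd hn' (half_le_log hd) hζ.1 hT
  have hexp : Real.exp (-(u ^ 2 / (16 * n))) = ζ / 2 := by
    have hlog : 0 ≤ Real.log (2 / ζ) :=
      Real.log_nonneg (by rw [le_div_iff₀ hζ.1]; linarith [hζ.2])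
    rw [hu, Real.sq_sqrt (by positivity), mul_div_cancel_left₀ _ (by positivity), ← Real.log_inv,
      Real.exp_log (by have := hζ.1; positivity), inv_div]
  set G : Set (Fin n → Fin d1 × Fin d2) := {x | ∀ M : Matrix (Fin d1) (Fin d2) ℝ,
    tripleNormMC r M ≤ 1 →
      |((d1 * d2 : ℝ) / n) * (∑ k : Fin n, (M (x k).1 (x k).2)^2) - (frobNorm M)^2|
        ≤ 1000 * d1 * d2 * max (T / n) √(T / n)} with hG
  have hae : AEMeasurable (fun ω k => idx k ω) (ℙ : Measure Ω) := by
    by_contra hcon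
    rw [Measure.map_of_not_aemeasurable hcon] at hmap
    have h1 := pi_uniform_apply (X := Fin d1 × Fin d2) (n := n) Set.univ
    rw [← hmap] at h1
    simp at h1
  change _ ≤ ℙ ((fun ω k => idx k ω) ⁻¹' G)
  rw [← Measure.map_apply_of_aemeasurable hae (Set.toFinite G).measurableSet, hmap,
    pi_uniform_apply, ← ENNReal.ofReal_one, ← ENNReal.ofReal_sub _ hζ.1.le]
  refine ENNReal.ofReal_le_ofReal ?_
  have hpos := factoredBall_deviation hd1 hd2 hn (c := 2 * √r) (u := u) (s := 1) (by positivity)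
    (Real.sqrt_nonneg _) (by simp)
  have hneg := factoredBall_deviation hd1 hd2 hn (c := 2 * √r) (u := u) (s := -1) (by positivity)
    (Real.sqrt_nonneg _) (by simp)
  rw [hexp, ← hv] at hpos hneg
  have hcover : ∀ x : Fin n → Fin d1 × Fin d2,
      x ∉ G → ∃ s ∈ ({1, -1} : Set ℝ), ∃ M ∈ factoredBall d1 d2 (2 * √r), v ≤
        s * (∑ k, M (x k).1 (x k).2 ^ 2 - n * 𝔼 z : Fin d1 × Fin d2, M z.1 z.2 ^ 2) := by
    intro x hx
    simp only [hG, Set.mem_ofPred_eq, not_forall, not_le] at hx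
    obtain ⟨M, hM, hlt⟩ := hx
    set D := ∑ k, M (x k).1 (x k).2 ^ 2 - n * 𝔼 z : Fin d1 × Fin d2, M z.1 z.2 ^ 2 with hD
    have hscale : ((d1 * d2 : ℝ) / n) * (∑ k : Fin n, (M (x k).1 (x k).2)^2) - (frobNorm M)^2
        = (d1 * d2 : ℝ) / n * D := by
      rw [hD, expect_sq_eq_frobNorm_sq_div]
      field_simp
    have hvD : v ≤ |D| := by
      rw [hscale, abs_mul, abs_of_pos (by positivity)] at hlt
      have h1 : 1000 * d1 * d2 * √(T / n) ≤ 1000 * d1 * d2 * max (T / n) √(T / n) :=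
        mul_le_mul_of_nonneg_left (le_max_right _ _) (by positivity)
      have h2 : √(T / n) = √(T * n) / n := by
        rw [show T / n = T * n / n ^ 2 by field_simp, Real.sqrt_div' _ (by positivity),
          Real.sqrt_sq hn'.le]
      have h3 : (d1 * d2 : ℝ) / n * (1000 * √(T * n)) < d1 * d2 / n * |D| := by
        refine lt_of_le_of_lt (le_trans (le_of_eq ?_) h1) hlt
        rw [h2]
        ring
      exact hvT.trans (lt_of_mul_lt_mul_left h3 (by positivity)).le
    rcases abs_cases D with ⟨h, _⟩ | ⟨h, _⟩
    · exact ⟨1, by simp, M, mem_factoredBall_of_tripleNormMC_le hr hM, by linarith⟩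
    · exact ⟨-1, by simp, M, mem_factoredBall_of_tripleNormMC_le hr hM, by linarith⟩
  have hsum : (1 : ℝ) ≤ 𝔼 x : Fin n → Fin d1 × Fin d2, ((if x ∈ G then (1 : ℝ) else 0) +
      (if ∃ M ∈ factoredBall d1 d2 (2 * √r), v ≤
        1 * (∑ k, M (x k).1 (x k).2 ^ 2 - n * 𝔼 z : Fin d1 × Fin d2, M z.1 z.2 ^ 2)
        then (1 : ℝ) else 0) +
      (if ∃ M ∈ factoredBall d1 d2 (2 * √r), v ≤
        -1 * (∑ k, M (x k).1 (x k).2 ^ 2 - n * 𝔼 z : Fin d1 × Fin d2, M z.1 z.2 ^ 2)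
        then (1 : ℝ) else 0)) := by
    refine Finset.le_expect Finset.univ_nonempty fun x _ => ?_
    by_cases hx : x ∈ G
    · rw [if_pos hx, add_assoc, le_add_iff_nonneg_right]
      exact add_nonneg (by split_ifs <;> simp) (by split_ifs <;> simp)
    · obtain ⟨s, hs, hbad⟩ := hcover x hx
      rcases hs with rfl | rfl
      · rw [if_neg hx, if_pos hbad, zero_add, le_add_iff_nonneg_right]
        split_ifs <;> simp
      · rw [if_neg hx, if_pos hbad, zero_add, le_add_iff_nonneg_left]
        split_ifs <;> simp
  rw [Finset.expect_add_distrib, Finset.expect_add_distrib] at hsum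
  linarith
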